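/- Let A be a left Leibniz algebra over a field F. Then A is perfect if and only if for every left Leibniz algebra K over F and every subalgebra J of K that is isomorphic to A as a Leibniz algebra, J is a subideal of K if and only if J is an ideal of K. -/

import Mathlib

/- A left Leibniz algebra over a field `F`. -/
universe u v

class LeibnizAlgebra (F : Type u) (A : Type v) [Field F] [AddCommGroup A] [Module F A]
    extends Bracket A A where
  add_lie' : ∀ x y z : A, ⁅x + y, z⁆ = ⁅x, z⁆ + ⁅y, z⁆
  lie_add' : ∀ x y z : A, ⁅x, y + z⁆ = ⁅x, y⁆ + ⁅x, z⁆
  smul_lie' : ∀ (t : F) (x y : A), ⁅t • x, y⁆ = t • ⁅x, y⁆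
  lie_smul' : ∀ (t : F) (x y : A), ⁅x, t • y⁆ = t • ⁅x, y⁆
  leibniz' : ∀ x y z : A, ⁅x, ⁅y, z⁆⁆ = ⁅⁅x, y⁆, z⁆ + ⁅y, ⁅x, z⁆⁆

section Defs

variable (F : Type u) {A : Type v} [Field F] [AddCommGroup A] [Module F A] [LeibnizAlgebra F A]

/-- A derivation of a Leibniz algebra. -/
def IsLeibnizDeriv (f : A →ₗ[F] A) : Prop :=
  ∀ x y : A, f ⁅x, y⁆ = ⁅f x, y⁆ + ⁅x, f y⁆

/-- A subalgebra of a Leibniz algebra: a subspace closed under the bracket. -/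
def IsLeibnizSubalg (S : Submodule F A) : Prop := ∀ x ∈ S, ∀ y ∈ S, ⁅x, y⁆ ∈ S

/-- A (two-sided) ideal of a Leibniz algebra. -/
def IsLeibnizIdeal (J : Submodule F A) : Prop :=
  ∀ (x : A), ∀ y ∈ J, ⁅x, y⁆ ∈ J ∧ ⁅y, x⁆ ∈ J

/-- `J` is an ideal of the subalgebra `S`. -/
def IsLeibnizIdealIn (J S : Submodule F A) : Prop :=
  J ≤ S ∧ ∀ x ∈ S, ∀ y ∈ J, ⁅x, y⁆ ∈ J ∧ ⁅y, x⁆ ∈ J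

/-- A subspace is perfect if it is spanned by brackets of its own elements. -/
def IsPerfectCarrier (S : Submodule F A) : Prop :=
  Submodule.span F {z : A | ∃ x ∈ S, ∃ y ∈ S, z = ⁅x, y⁆} = S

end Defs

/-- A Leibniz algebra is perfect if it coincides with its derived subalgebra. -/
def IsPerfectLeibniz (F : Type u) (A : Type v) [Field F] [AddCommGroup A] [Module F A]
    [LeibnizAlgebra F A] : Prop :=
  Submodule.span F {z : A | ∃ x y : A, z = ⁅x, y⁆} = ⊤

/-- `J` is (the image of) an isomorphic copy of the Leibniz algebra `A` inside `K`. -/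
def IsIsoCopy (F : Type u) (A : Type v) [Field F] [AddCommGroup A] [Module F A]
    [LeibnizAlgebra F A] {K : Type v} [AddCommGroup K] [Module F K] [LeibnizAlgebra F K]
    (J : Submodule F K) : Prop :=
  ∃ e : A →ₗ[F] K, Function.Injective e ∧ LinearMap.range e = J ∧
    ∀ x y : A, e ⁅x, y⁆ = ⁅e x, e y⁆

/-- `J` is a subideal of the Leibniz algebra `M`: there is a finite chain of subalgebras
`J = K₀ ⊴ K₁ ⊴ ⋯ ⊴ Kₙ = M`, each an ideal of the next. -/
def IsLeibnizSubideal (F : Type u) {M : Type v} [Field F] [AddCommGroup M] [Module F M]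
    [LeibnizAlgebra F M] (J : Submodule F M) : Prop :=
  ∃ (n : ℕ) (c : Fin (n + 1) → Submodule F M),
    c 0 = J ∧ c (Fin.last n) = ⊤ ∧
    ∀ i : Fin n, IsLeibnizIdealIn F (c i.castSucc) (c i.succ)

section Helpers

variable {F : Type u} {A : Type v} [Field F] [AddCommGroup A] [Module F A] [LeibnizAlgebra F A]

/-- A perfect ideal of an ideal is an ideal. -/
theorem IsLeibnizIdealIn.trans_of_perfect {J S T : Submodule F A}
    (hJ : IsPerfectCarrier F J) (hJS : IsLeibnizIdealIn F J S) (hST : IsLeibnizIdealIn F S T) :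
    IsLeibnizIdealIn F J T := by
  refine ⟨hJS.1.trans hST.1, fun x hx y hy => ?_⟩
  rw [← hJ] at hy
  induction hy using Submodule.span_induction with
  | mem w hw =>
    obtain ⟨y, hy, z, hz, rfl⟩ := hw
    have hxy := hST.2 x hx y (hJS.1 hy)
    have hxz := hST.2 x hx z (hJS.1 hz)
    refine ⟨?_, ?_⟩
    · rw [LeibnizAlgebra.leibniz' (F := F) x y z]
      exact J.add_mem (hJS.2 _ hxy.1 z hz).1 (hJS.2 _ hxz.1 y hy).2
    · rw [eq_sub_of_add_eq (LeibnizAlgebra.leibniz' (F := F) y z x).symm]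
      exact J.sub_mem (hJS.2 _ hxz.2 y hy).2 (hJS.2 _ hxy.2 z hz).2
  | zero =>
    have h₁ := LeibnizAlgebra.lie_smul' (0 : F) x (0 : A)
    have h₂ := LeibnizAlgebra.smul_lie' (0 : F) (0 : A) x
    rw [zero_smul, zero_smul] at h₁ h₂
    rw [h₁, h₂]
    exact ⟨J.zero_mem, J.zero_mem⟩
  | add y z _ _ hy hz =>
    rw [LeibnizAlgebra.lie_add' (F := F), LeibnizAlgebra.add_lie' (F := F)]
    exact ⟨J.add_mem hy.1 hz.1, J.add_mem hy.2 hz.2⟩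
  | smul t y _ hy =>
    rw [LeibnizAlgebra.lie_smul', LeibnizAlgebra.smul_lie']
    exact ⟨J.smul_mem t hy.1, J.smul_mem t hy.2⟩

/-- A perfect subideal is an ideal. -/
theorem IsLeibnizSubideal.isLeibnizIdeal_of_perfect {J : Submodule F A}
    (hJ : IsPerfectCarrier F J) (hs : IsLeibnizSubalg F J) (h : IsLeibnizSubideal F J) :
    IsLeibnizIdeal F J := by
  obtain ⟨n, c, h₀, hn, hc⟩ := h
  have key : ∀ i : Fin (n + 1), IsLeibnizIdealIn F J (c i) := by
    intro i
    induction i using Fin.induction with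
    | zero => exact ⟨h₀.ge, fun x hx y hy => ⟨hs x (h₀ ▸ hx) y hy, hs y hy x (h₀ ▸ hx)⟩⟩
    | succ i ih => exact ih.trans_of_perfect hJ (hc i)
  exact fun x => (key (Fin.last n)).2 x (hn ▸ Submodule.mem_top)

/-- An ideal is a subideal. -/
theorem IsLeibnizIdeal.isLeibnizSubideal {J : Submodule F A} (h : IsLeibnizIdeal F J) :
    IsLeibnizSubideal F J :=
  ⟨1, ![J, ⊤], rfl, rfl, fun i => by
    obtain rfl := Subsingleton.elim i 0
    exact ⟨le_top, fun x _ => h x⟩⟩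

/-- An isomorphic copy of a perfect algebra is perfect. -/
theorem IsIsoCopy.isPerfectCarrier {K : Type v} [AddCommGroup K] [Module F K]
    [LeibnizAlgebra F K] {J : Submodule F K} (h : IsIsoCopy F A J) (hA : IsPerfectLeibniz F A) :
    IsPerfectCarrier F J := by
  obtain ⟨e, -, rfl, he⟩ := h
  have himage : {z : K | ∃ x ∈ LinearMap.range e, ∃ y ∈ LinearMap.range e, z = ⁅x, y⁆} =
      e '' {z : A | ∃ x y : A, z = ⁅x, y⁆} := by
    ext z
    constructor
    · rintro ⟨_, ⟨x, rfl⟩, _, ⟨y, rfl⟩, rfl⟩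
      exact ⟨⁅x, y⁆, ⟨x, y, rfl⟩, he x y⟩
    · rintro ⟨_, ⟨x, y, rfl⟩, rfl⟩
      exact ⟨e x, ⟨x, rfl⟩, e y, ⟨y, rfl⟩, he x y⟩
  rw [IsPerfectCarrier, himage, Submodule.span_image, hA, Submodule.map_top]

/-- The Leibniz algebra structure on `A × A × A` with bracket
`⁅(a, b, c), (a', b', c')⁆ = (⁅a, a'⁆, (φ c * φ a') • a₀, 0)`,
where `φ` is a functional vanishing on all brackets. -/
@[reducible]
def leibnizAlgebraOfFunctional (φ : A →ₗ[F] F) (hφ : ∀ x y : A, φ ⁅x, y⁆ = 0) (a₀ : A) :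
    LeibnizAlgebra F (A × A × A) where
  bracket x y := (⁅x.1, y.1⁆, (φ x.2.2 * φ y.1) • a₀, 0)
  add_lie' x y z := by
    simp [LeibnizAlgebra.add_lie' (F := F), add_mul, add_smul]
  lie_add' x y z := by
    simp [LeibnizAlgebra.lie_add' (F := F), mul_add, add_smul]
  smul_lie' t x y := by
    simp [LeibnizAlgebra.smul_lie', mul_assoc, mul_smul]
  lie_smul' t x y := by
    simp [LeibnizAlgebra.lie_smul', mul_left_comm, mul_smul]
  leibniz' x y z := by
    simp [hφ, ← LeibnizAlgebra.leibniz' (F := F)]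

/-- The brackets of a non-perfect algebra are annihilated by some nonzero functional. -/
theorem exists_functional_of_not_perfect (h : ¬ IsPerfectLeibniz F A) :
    ∃ (φ : A →ₗ[F] F) (a₀ : A), φ a₀ ≠ 0 ∧ ∀ x y : A, φ ⁅x, y⁆ = 0 := by
  obtain ⟨a₀, -, ha₀⟩ := SetLike.exists_of_lt (lt_top_iff_ne_top.2 h)
  obtain ⟨φ, hφ, hle⟩ := Submodule.exists_le_ker_of_notMem ha₀
  exact ⟨φ, a₀, hφ, fun x y => hle (Submodule.subset_span ⟨x, y, rfl⟩)⟩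

end Helpers

theorem perfect_iff_subideal_iff_ideal (F : Type u) (A : Type v) [Field F] [AddCommGroup A]
    [Module F A] [LeibnizAlgebra F A] :
    IsPerfectLeibniz F A ↔
      ∀ (K : Type v) [AddCommGroup K] [Module F K] [LeibnizAlgebra F K]
        (J : Submodule F K), IsLeibnizSubalg F J → IsIsoCopy F A J →
        (IsLeibnizSubideal F J ↔ IsLeibnizIdeal F J) := by
  refine ⟨fun hA K _ _ _ J hs hJ => ⟨fun h =>
    h.isLeibnizIdeal_of_perfect (hJ.isPerfectCarrier hA) hs, fun h => h.isLeibnizSubideal⟩, ?_⟩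
  intro H
  by_contra hA
  obtain ⟨φ, a₀, ha₀, hφ⟩ := exists_functional_of_not_perfect hA
  let := leibnizAlgebraOfFunctional φ hφ a₀
  have hbr (x y : A × A × A) : ⁅x, y⁆ = (⁅x.1, y.1⁆, (φ x.2.2 * φ y.1) • a₀, 0) := rfl
  let e : A →ₗ[F] A × A × A := LinearMap.inl F A (A × A)
  let L : Submodule F (A × A × A) :=
    LinearMap.ker (LinearMap.snd F A A ∘ₗ LinearMap.snd F A (A × A))
  have hmem (x : A × A × A) : x ∈ LinearMap.range e ↔ x.2 = 0 := by
    simp [e, LinearMap.range_inl]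
  have hmemL (x : A × A × A) : x ∈ L ↔ x.2.2 = 0 := by simp [L]
  have hsub : IsLeibnizSubalg F (LinearMap.range e) := by
    intro x hx y hy
    rw [hmem] at *
    simp [hbr, hx]
  have hcopy : IsIsoCopy F A (LinearMap.range e) :=
    ⟨e, LinearMap.inl_injective, rfl, fun x y => by simp [hbr, e, Prod.ext_iff]⟩
  have hideal : IsLeibnizIdeal F (LinearMap.range e) := by
    refine (H _ _ hsub hcopy).1 ⟨2, ![LinearMap.range e, L, ⊤], rfl, rfl, fun i => ?_⟩
    fin_cases i
    · refine ⟨fun x hx => (hmemL x).2 (by rw [(hmem x).1 hx]; rfl), fun x hx y hy => ?_⟩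
      replace hx := (hmemL x).1 hx
      replace hy := (hmem y).1 hy
      exact ⟨(hmem _).2 (by simp [hbr, hx]), (hmem _).2 (by simp [hbr, hy])⟩
    · exact ⟨le_top, fun x _ y _ => ⟨(hmemL _).2 rfl, (hmemL _).2 rfl⟩⟩
  have h := (hmem _).1 (hideal (0, 0, a₀) (e a₀) ⟨a₀, rfl⟩).1
  have ha₀' : a₀ ≠ 0 := fun h => ha₀ (by rw [h, map_zero])
  simp [hbr, e, ha₀, ha₀'] at h
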